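/- Let p be an interior point of N and let f : ℝ^d → ℝ be bounded and measurable on N and twice continuously differentiable on some open neighborhood of p. Then Δ_h f(p) → (1/|N|) Δf(p) as h → 0+. -/

import Mathlib

open MeasureTheory Real Filter
open scoped Topology

/-- The Gaussian kernel `K(u) = (4π)^{-d/2} e^{-‖u‖²/4}` on `ℝ^d`. -/
noncomputable def gaussK (d : ℕ) (u : EuclideanSpace ℝ (Fin d)) : ℝ :=
  (4 * π) ^ (-(d : ℝ) / 2) * Real.exp (-‖u‖ ^ 2 / 4)

/-- The Euclidean Laplacian `Δf(p) = ∑ᵢ ∂²f/∂xᵢ²(p)`. -/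
noncomputable def eucLap (d : ℕ) (f : EuclideanSpace ℝ (Fin d) → ℝ)
    (p : EuclideanSpace ℝ (Fin d)) : ℝ :=
  ∑ i : Fin d,
    iteratedFDeriv ℝ 2 f p ![EuclideanSpace.single i 1, EuclideanSpace.single i 1]

/-- The averaging kernel operator
`Δ_h f(p) = h^{-(d+2)} E[K((p-X)/h)(f(X)-f(p))]`, where `X` is uniform on `N`. -/
noncomputable def avgLap (d : ℕ) (N : Set (EuclideanSpace ℝ (Fin d)))
    (f : EuclideanSpace ℝ (Fin d) → ℝ) (h : ℝ) (p : EuclideanSpace ℝ (Fin d)) : ℝ :=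
  (h ^ (d + 2))⁻¹ * (((volume N).toReal)⁻¹ *
    ∫ x in N, gaussK d (h⁻¹ • (p - x)) * (f x - f p))

/-- Second-order Taylor expansion with Peano remainder. -/
theorem ContDiffAt.taylor_two_isLittleO {E : Type*} [NormedAddCommGroup E] [NormedSpace ℝ E]
    {f : E → ℝ} {p : E} (hf : ContDiffAt ℝ 2 f p) :
    (fun v => f (p + v) - f p - fderiv ℝ f p v - 2⁻¹ * fderiv ℝ (fderiv ℝ f) p v v)
      =o[𝓝 0] fun v => ‖v‖ ^ 2 := by
  have hsymm : IsSymmSndFDerivAt ℝ f p := hf.isSymmSndFDerivAt (by simp)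
  have hd2 : HasFDerivAt (fderiv ℝ f) (fderiv ℝ (fderiv ℝ f) p) p :=
    ((hf.fderiv_right (m := 1) (by norm_num)).differentiableAt (by norm_num)).hasFDerivAt
  have hd1 : ∀ᶠ x in 𝓝 p, HasFDerivAt f (fderiv ℝ f x) x := by
    filter_upwards [hf.eventually (by simp)] with x hx
    exact (hx.differentiableAt (by norm_num)).hasFDerivAt
  rw [hasFDerivAt_iff_isLittleO_nhds_zero] at hd2
  have hd1' : ∀ᶠ v in 𝓝 (0 : E), HasFDerivAt f (fderiv ℝ f (p + v)) (p + v) := by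
    have : Tendsto (fun v : E => p + v) (𝓝 0) (𝓝 p) := by
      simpa using (continuous_const_add p).tendsto (0 : E)
    exact this.eventually hd1
  rw [Asymptotics.isLittleO_iff]
  intro c hc
  obtain ⟨r, hr, hball⟩ := Metric.eventually_nhds_iff_ball.1 (hd1'.and (hd2.def hc))
  filter_upwards [Metric.ball_mem_nhds (0 : E) hr] with v hv
  set D := fderiv ℝ (fderiv ℝ f) p
  have hder : ∀ w ∈ Metric.closedBall (0 : E) ‖v‖,
      HasFDerivWithinAt
        (fun w => f (p + w) - f p - fderiv ℝ f p w - 2⁻¹ * D w w)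
        (fderiv ℝ f (p + w) - fderiv ℝ f p - D w) (Metric.closedBall 0 ‖v‖) w := by
    intro w hw
    have hw' : w ∈ Metric.ball (0 : E) r := by
      simp only [Metric.mem_closedBall, Metric.mem_ball, dist_zero_right] at hw hv ⊢
      exact hw.trans_lt hv
    have h1 : HasFDerivAt (fun w => f (p + w)) (fderiv ℝ f (p + w)) w :=
      (hasFDerivAt_comp_add_left p).2 (hball w hw').1
    have h2 : HasFDerivAt (fun w => D w w) ((D w).comp (.id ℝ E) + D.flip w) w := by
      convert! D.hasFDerivAt.clm_apply (hasFDerivAt_id w) using 1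
    have h3 := ((h1.sub_const (f p)).sub (fderiv ℝ f p).hasFDerivAt).sub (h2.const_mul 2⁻¹)
    refine (h3.congr_fderiv ?_).hasFDerivWithinAt
    ext z
    have := hsymm.eq z w
    simp only [sub_apply, smul_apply,
      add_apply, ContinuousLinearMap.comp_apply, ContinuousLinearMap.flip_apply,
      ContinuousLinearMap.id_apply, smul_eq_mul, D]
    rw [this]
    ring
  have hbound : ∀ w ∈ Metric.closedBall (0 : E) ‖v‖,
      ‖fderiv ℝ f (p + w) - fderiv ℝ f p - D w‖ ≤ c * ‖v‖ := by
    intro w hw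
    simp only [Metric.mem_closedBall, Metric.mem_ball, dist_zero_right] at hw hv
    have hw' : w ∈ Metric.ball (0 : E) r := by simpa using hw.trans_lt hv
    exact (hball w hw').2.trans (by gcongr)
  have := (convex_closedBall (0 : E) ‖v‖).norm_image_sub_le_of_norm_hasFDerivWithin_le
    hder hbound (x := 0) (y := v) (by simp) (by simp)
  simp only [add_zero, sub_self, map_zero, mul_zero, sub_zero] at this
  rw [norm_pow, norm_norm]
  calc _ ≤ _ := this
    _ = _ := by ring

theorem integrable_pow_mul_gaussianPDFReal (n : ℕ) :
    Integrable fun x : ℝ => x ^ n * ProbabilityTheory.gaussianPDFReal 0 2 x := by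
  have h := (integrable_rpow_mul_exp_neg_mul_sq (b := 1 / 4) (by norm_num) (s := n)
    (by have : (0 : ℝ) ≤ n := n.cast_nonneg
        linarith)).const_mul (√(2 * π * 2))⁻¹
  refine h.congr (.of_forall fun x => ?_)
  simp only [ProbabilityTheory.gaussianPDFReal, rpow_natCast, sub_zero, NNReal.coe_ofNat]
  rw [show -(1 / 4) * x ^ 2 = -x ^ 2 / (2 * 2) by ring]
  ring

theorem integral_mul_gaussianPDFReal :
    ∫ x : ℝ, x ^ 1 * ProbabilityTheory.gaussianPDFReal 0 2 x = 0 := by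
  have h := ProbabilityTheory.integral_id_gaussianReal (μ := 0) (v := 2)
  rw [ProbabilityTheory.integral_gaussianReal_eq_integral_smul (by norm_num)] at h
  simpa [mul_comm] using h

theorem integral_sq_mul_gaussianPDFReal :
    ∫ x : ℝ, x ^ 2 * ProbabilityTheory.gaussianPDFReal 0 2 x = 2 := by
  have h := ProbabilityTheory.variance_id_gaussianReal (μ := 0) (v := 2)
  rw [ProbabilityTheory.variance_eq_integral aemeasurable_id] at h
  simp only [id, ProbabilityTheory.integral_id_gaussianReal] at h
  rw [ProbabilityTheory.integral_gaussianReal_eq_integral_smul (by norm_num)] at h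
  simpa [mul_comm] using h

section GaussK

variable {d : ℕ}

theorem gaussK_eq_prod (u : EuclideanSpace ℝ (Fin d)) :
    gaussK d u = ∏ i, ProbabilityTheory.gaussianPDFReal 0 2 (u i) := by
  simp only [gaussK, ProbabilityTheory.gaussianPDFReal, Finset.prod_mul_distrib, sub_zero,
    Finset.prod_const, Finset.card_univ, Fintype.card_fin, ← Real.exp_sum, NNReal.coe_ofNat]
  congr 1
  · rw [show 2 * π * 2 = 4 * π by ring, sqrt_eq_rpow, ← rpow_neg (by positivity), ← rpow_natCast,
      ← rpow_mul (by positivity)]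
    congr 1
    ring
  · rw [EuclideanSpace.real_norm_sq_eq, ← Finset.sum_div, Finset.sum_neg_distrib]
    norm_num

theorem gaussK_nonneg (u : EuclideanSpace ℝ (Fin d)) : 0 ≤ gaussK d u := by
  unfold gaussK
  positivity

theorem continuous_gaussK : Continuous (gaussK d) := by
  unfold gaussK
  fun_prop

theorem gaussK_neg (u : EuclideanSpace ℝ (Fin d)) : gaussK d (-u) = gaussK d u := by
  simp [gaussK]

theorem gaussK_mul_coord_mul_coord (i j : Fin d) (u : EuclideanSpace ℝ (Fin d)) :
    gaussK d u * (u i * u j) =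
      ∏ m, (u m ^ ((if m = i then 1 else 0) + (if m = j then 1 else 0)) *
        ProbabilityTheory.gaussianPDFReal 0 2 (u m)) := by
  simp only [pow_add, Finset.prod_mul_distrib, gaussK_eq_prod]
  simp
  ring

theorem integrable_gaussK_mul_coord_mul_coord (i j : Fin d) :
    Integrable fun u : EuclideanSpace ℝ (Fin d) => gaussK d u * (u i * u j) := by
  simp only [gaussK_mul_coord_mul_coord]
  have h := Integrable.fintype_prod (f := fun (m : Fin d) => _) fun m =>
    integrable_pow_mul_gaussianPDFReal ((if m = i then 1 else 0) + (if m = j then 1 else 0))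
  exact ((PiLp.volume_preserving_ofLp (Fin d)).integrable_comp_emb
    (MeasurableEquiv.toLp 2 (Fin d → ℝ)).symm.measurableEmbedding).2 h

theorem integral_gaussK_mul_coord_mul_coord (i j : Fin d) :
    ∫ u : EuclideanSpace ℝ (Fin d), gaussK d u * (u i * u j) = if i = j then 2 else 0 := by
  simp only [gaussK_mul_coord_mul_coord]
  have h := (PiLp.volume_preserving_ofLp (Fin d)).integral_comp
    (MeasurableEquiv.toLp 2 (Fin d → ℝ)).symm.measurableEmbedding
    (fun x : Fin d → ℝ => ∏ m, (x m ^ ((if m = i then 1 else 0) + (if m = j then 1 else 0)) *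
        ProbabilityTheory.gaussianPDFReal 0 2 (x m)))
  rw [h, integral_fintype_prod_volume_eq_prod (f := fun m x =>
    x ^ ((if m = i then 1 else 0) + (if m = j then 1 else 0)) *
        ProbabilityTheory.gaussianPDFReal 0 2 x)]
  split_ifs with hij
  · subst hij
    rw [Finset.prod_eq_single i]
    · simpa using integral_sq_mul_gaussianPDFReal
    · intro m _ hm
      simpa [hm] using ProbabilityTheory.integral_gaussianPDFReal_eq_one 0 (v := 2) (by norm_num)
    · simp
  · refine Finset.prod_eq_zero (Finset.mem_univ i) ?_
    simpa [hij] using integral_mul_gaussianPDFReal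

theorem integrable_gaussK_mul_norm_sq :
    Integrable fun u : EuclideanSpace ℝ (Fin d) => gaussK d u * ‖u‖ ^ 2 := by
  have h := integrable_finsetSum Finset.univ
    fun (i : Fin d) _ => integrable_gaussK_mul_coord_mul_coord i i
  refine h.congr (.of_forall fun u => ?_)
  beta_reduce
  rw [EuclideanSpace.real_norm_sq_eq, Finset.mul_sum]
  simp only [sq]

theorem integrable_gaussK : Integrable (gaussK d) := by
  have h := Integrable.fintype_prod (f := fun (_ : Fin d) => _)
    fun _ => ProbabilityTheory.integrable_gaussianPDFReal 0 2
  have h' := ((PiLp.volume_preserving_ofLp (Fin d)).integrable_comp_emb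
    (MeasurableEquiv.toLp 2 (Fin d → ℝ)).symm.measurableEmbedding).2 h
  exact h'.congr (.of_forall fun u => (gaussK_eq_prod u).symm)

theorem integrable_gaussK_mul_clm (L : EuclideanSpace ℝ (Fin d) →L[ℝ] ℝ) :
    Integrable fun u : EuclideanSpace ℝ (Fin d) => gaussK d u * L u := by
  refine ((integrable_gaussK.add integrable_gaussK_mul_norm_sq).const_mul ‖L‖).mono'
    (continuous_gaussK.mul L.continuous).aestronglyMeasurable (.of_forall fun u => ?_)
  rw [norm_mul, norm_of_nonneg (gaussK_nonneg u)]
  have h1 : ‖L u‖ ≤ ‖L‖ * (1 + ‖u‖ ^ 2) :=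
    (L.le_opNorm u).trans (by gcongr; nlinarith [sq_nonneg (‖u‖ - 1)])
  calc gaussK d u * ‖L u‖ ≤ gaussK d u * (‖L‖ * (1 + ‖u‖ ^ 2)) :=
        mul_le_mul_of_nonneg_left h1 (gaussK_nonneg u)
    _ = _ := by simp only [Pi.add_apply]; ring

theorem integral_gaussK_mul_clm (L : EuclideanSpace ℝ (Fin d) →L[ℝ] ℝ) :
    ∫ u : EuclideanSpace ℝ (Fin d), gaussK d u * L u = 0 := by
  have h := integral_neg_eq_self (fun u : EuclideanSpace ℝ (Fin d) => gaussK d u * L u) volume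
  simp only [gaussK_neg, map_neg, mul_neg, integral_neg] at h
  linarith

theorem integral_gaussK_mul_bilin
    (Q : EuclideanSpace ℝ (Fin d) →L[ℝ] EuclideanSpace ℝ (Fin d) →L[ℝ] ℝ) :
    ∫ u : EuclideanSpace ℝ (Fin d), gaussK d u * (2⁻¹ * Q u u) =
      ∑ i, Q (EuclideanSpace.single i 1) (EuclideanSpace.single i 1) := by
  have hQ (u : EuclideanSpace ℝ (Fin d)) : gaussK d u * (2⁻¹ * Q u u) =
      ∑ i, ∑ j, 2⁻¹ * Q (EuclideanSpace.single i 1) (EuclideanSpace.single j 1) *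
        (gaussK d u * (u i * u j)) := by
    have hu : u = ∑ i, u i • EuclideanSpace.single i (1 : ℝ) := by
      simpa using ((EuclideanSpace.basisFun (Fin d) ℝ).sum_repr u).symm
    conv_lhs => enter [2, 2]; rw [hu]
    simp only [map_sum, map_smul, sum_apply, smul_apply,
      smul_eq_mul, Finset.mul_sum]
    rw [Finset.sum_comm]
    refine Finset.sum_congr rfl fun i _ => Finset.sum_congr rfl fun j _ => ?_
    ring
  simp only [hQ]
  rw [integral_finsetSum _ fun i _ => integrable_finsetSum _ fun j _ =>
    (integrable_gaussK_mul_coord_mul_coord i j).const_mul _]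
  refine Finset.sum_congr rfl fun i _ => ?_
  rw [integral_finsetSum _ fun j _ => (integrable_gaussK_mul_coord_mul_coord i j).const_mul _]
  simp only [integral_const_mul, integral_gaussK_mul_coord_mul_coord]
  simp
  ring

theorem norm_gaussK_mul_comp_smul_le {F : EuclideanSpace ℝ (Fin d) → ℝ} {C h : ℝ}
    (hF : ∀ v, |F v| ≤ C * ‖v‖ ^ 2) (hh : 0 < h) (u : EuclideanSpace ℝ (Fin d)) :
    ‖gaussK d u * ((h ^ 2)⁻¹ * F (h • u))‖ ≤ C * (gaussK d u * ‖u‖ ^ 2) := by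
  have h1 := hF (h • u)
  rw [norm_smul, norm_of_nonneg hh.le, mul_pow] at h1
  rw [norm_mul, norm_of_nonneg (gaussK_nonneg u), norm_mul, norm_of_nonneg (by positivity),
    Real.norm_eq_abs]
  calc gaussK d u * ((h ^ 2)⁻¹ * |F (h • u)|)
      ≤ gaussK d u * ((h ^ 2)⁻¹ * (C * (h ^ 2 * ‖u‖ ^ 2))) := by
        have := gaussK_nonneg u
        gcongr
    _ = C * (gaussK d u * ‖u‖ ^ 2) := by field_simp

/-- Gaussian averages of a function with a pure second-order expansion at the origin. -/
theorem tendsto_integral_gaussK_mul_comp_smul {F : EuclideanSpace ℝ (Fin d) → ℝ}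
    {Q : EuclideanSpace ℝ (Fin d) →L[ℝ] EuclideanSpace ℝ (Fin d) →L[ℝ] ℝ} {C : ℝ}
    (hmeas : AEStronglyMeasurable F) (hF : ∀ v, |F v| ≤ C * ‖v‖ ^ 2)
    (hFQ : (fun v => F v - 2⁻¹ * Q v v) =o[𝓝 0] fun v => ‖v‖ ^ 2) :
    Tendsto (fun h : ℝ => ∫ u, gaussK d u * ((h ^ 2)⁻¹ * F (h • u))) (𝓝[>] 0)
      (𝓝 (∑ i, Q (EuclideanSpace.single i 1) (EuclideanSpace.single i 1))) := by
  rw [← integral_gaussK_mul_bilin]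
  refine tendsto_integral_filter_of_dominated_convergence
    (fun u => C * (gaussK d u * ‖u‖ ^ 2)) ?_ ?_ (integrable_gaussK_mul_norm_sq.const_mul C) ?_
  · filter_upwards [self_mem_nhdsWithin] with h (hh : 0 < h)
    exact continuous_gaussK.aestronglyMeasurable.mul ((hmeas.comp_quasiMeasurePreserving
      (Measure.quasiMeasurePreserving_smul volume hh.ne')).const_mul _)
  · filter_upwards [self_mem_nhdsWithin] with h (hh : 0 < h)
    exact .of_forall (norm_gaussK_mul_comp_smul_le hF hh)
  · refine .of_forall fun u => ?_
    refine Tendsto.const_mul _ ?_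
    have ht : Tendsto (fun h : ℝ => h • u) (𝓝[>] 0) (𝓝 0) := by
      have : Tendsto (fun h : ℝ => h • u) (𝓝 0) (𝓝 ((0 : ℝ) • u)) :=
        (continuous_id.smul continuous_const).tendsto 0
      rw [zero_smul] at this
      exact this.mono_left nhdsWithin_le_nhds
    have ho : (fun h : ℝ => F (h • u) - 2⁻¹ * Q (h • u) (h • u)) =o[𝓝[>] 0]
        fun h : ℝ => h ^ 2 := by
      refine (hFQ.comp_tendsto ht).trans_isBigO ?_
      refine Asymptotics.IsBigO.of_bound (‖u‖ ^ 2) (.of_forall fun h => ?_)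
      simp [norm_smul, mul_pow, mul_comm]
    have hlim := (ho.tendsto_div_nhds_zero).add_const (2⁻¹ * Q u u)
    rw [zero_add] at hlim
    refine hlim.congr' ?_
    filter_upwards [self_mem_nhdsWithin] with h (hh : 0 < h)
    simp only [map_smul, smul_apply, smul_eq_mul]
    field_simp
    ring

end GaussK

theorem avgLap_eq_integral {d : ℕ} {N : Set (EuclideanSpace ℝ (Fin d))} (hN : MeasurableSet N)
    (f : EuclideanSpace ℝ (Fin d) → ℝ) (p : EuclideanSpace ℝ (Fin d)) {h : ℝ} (hh : 0 < h) :
    avgLap d N f h p = ((volume N).toReal)⁻¹ *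
      ∫ u, gaussK d u * ((h ^ 2)⁻¹ * N.indicator (fun x => f x - f p) (p + h • u)) := by
  set G : EuclideanSpace ℝ (Fin d) → ℝ := N.indicator fun x => f x - f p
  have h1 : ∫ x in N, gaussK d (h⁻¹ • (p - x)) * (f x - f p)
      = ∫ x, gaussK d (h⁻¹ • (p - x)) * G x := by
    rw [← integral_indicator hN]
    refine integral_congr_ae (.of_forall fun x => ?_)
    by_cases hx : x ∈ N <;> simp [G, hx]
  have h2 : ∫ x, gaussK d (h⁻¹ • (p - x)) * G x
      = ∫ v, gaussK d (h⁻¹ • v) * G (p + v) := by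
    rw [← integral_add_left_eq_self _ p]
    refine integral_congr_ae (.of_forall fun v => ?_)
    simp only [sub_add_cancel_left, smul_neg, gaussK_neg]
  have h3 := Measure.integral_comp_smul volume
    (fun v : EuclideanSpace ℝ (Fin d) => gaussK d (h⁻¹ • v) * G (p + v)) h
  simp only [inv_smul_smul₀ hh.ne', finrank_euclideanSpace_fin, smul_eq_mul] at h3
  rw [abs_of_pos (by positivity)] at h3
  have h4 (u : EuclideanSpace ℝ (Fin d)) : gaussK d u * ((h ^ 2)⁻¹ * G (p + h • u)) =
      (h ^ 2)⁻¹ * (gaussK d u * G (p + h • u)) := by ring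
  simp only [avgLap, h1, h2, h4, integral_const_mul, h3]
  rw [pow_add, mul_inv]
  ring

theorem stmt2 (d : ℕ) (hd : 1 ≤ d) (N : Set (EuclideanSpace ℝ (Fin d)))
    (hNcomp : IsCompact N) (hNpos : 0 < volume N)
    (p : EuclideanSpace ℝ (Fin d)) (hp : p ∈ interior N)
    (f : EuclideanSpace ℝ (Fin d) → ℝ) (B : ℝ)
    (hfmeas : AEMeasurable f (volume.restrict N))
    (hfbdd : ∀ x ∈ N, |f x| ≤ B)
    (V : Set (EuclideanSpace ℝ (Fin d))) (hV : IsOpen V) (hpV : p ∈ V)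
    (hfsm : ContDiffOn ℝ 2 f V) :
    Tendsto (fun h : ℝ => avgLap d N f h p) (𝓝[>] 0)
      (𝓝 (((volume N).toReal)⁻¹ * eucLap d f p)) := by
  have hNm : MeasurableSet N := hNcomp.measurableSet
  set L := fderiv ℝ f p
  set Q := fderiv ℝ (fderiv ℝ f) p
  set G : EuclideanSpace ℝ (Fin d) → ℝ := N.indicator fun x => f x - f p with hG
  set F : EuclideanSpace ℝ (Fin d) → ℝ := fun v => G (p + v) - L v with hFdef
  have hmeas : AEStronglyMeasurable F := by
    have hGm : AEStronglyMeasurable G :=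
      ((aemeasurable_indicator_iff hNm).2 (hfmeas.sub_const _)).aestronglyMeasurable
    exact (hGm.comp_quasiMeasurePreserving
      (measurePreserving_add_left volume p).quasiMeasurePreserving).sub
      L.continuous.aestronglyMeasurable
  have hFQ : (fun v => F v - 2⁻¹ * Q v v) =o[𝓝 0] fun v => ‖v‖ ^ 2 := by
    refine (hfsm.contDiffAt (hV.mem_nhds hpV)).taylor_two_isLittleO.congr' ?_ .rfl
    have ht : Tendsto (fun v => p + v) (𝓝 0) (𝓝 p) := by
      simpa using (continuous_const_add p).tendsto 0
    filter_upwards [ht (mem_interior_iff_mem_nhds.1 hp)] with v hv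
    have hv' : p + v ∈ N := hv
    simp [hFdef, hG, hv', L, Q]
  obtain ⟨C, hC⟩ : ∃ C, ∀ v, |F v| ≤ C * ‖v‖ ^ 2 := by
    obtain ⟨r, hr, hball⟩ := Metric.eventually_nhds_iff_ball.1 (hFQ.def one_pos)
    have hB : 0 ≤ B := (abs_nonneg _).trans (hfbdd p (interior_subset hp))
    refine ⟨(1 + 2⁻¹ * ‖Q‖) + (2 * B / r ^ 2 + ‖L‖ / r), fun v => ?_⟩
    rw [add_mul]
    rcases lt_or_ge ‖v‖ r with hv | hv
    · have h1 := hball v (by simpa using hv)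
      have h2 := Q.le_opNorm₂ v v
      rw [norm_pow, norm_norm, Real.norm_eq_abs] at h1
      rw [Real.norm_eq_abs] at h2
      have h3 : |F v| ≤ |F v - 2⁻¹ * Q v v| + 2⁻¹ * |Q v v| := by
        have := abs_add_le (F v - 2⁻¹ * Q v v) (2⁻¹ * Q v v)
        rwa [sub_add_cancel, abs_mul, abs_of_pos (by norm_num : (0 : ℝ) < 2⁻¹)] at this
      have h4 : 0 ≤ (2 * B / r ^ 2 + ‖L‖ / r) * ‖v‖ ^ 2 := by positivity
      nlinarith
    · have h1 : |G (p + v)| ≤ 2 * B := by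
        by_cases hx : p + v ∈ N
        · have := abs_sub (f (p + v)) (f p)
          simp only [hG, Set.indicator_of_mem hx]
          linarith [hfbdd _ hx, hfbdd p (interior_subset hp)]
        · simp only [hG, Set.indicator_of_notMem hx, abs_zero]
          positivity
      have h2 : |L v| ≤ ‖L‖ * ‖v‖ := L.le_opNorm v
      have h3 : |F v| ≤ |G (p + v)| + |L v| := abs_sub _ _
      have h4 : 2 * B ≤ 2 * B / r ^ 2 * ‖v‖ ^ 2 := by
        rw [div_mul_eq_mul_div, le_div_iff₀ (by positivity)]
        gcongr
      have h5 : ‖L‖ * ‖v‖ ≤ ‖L‖ / r * ‖v‖ ^ 2 := by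
        rw [div_mul_eq_mul_div, le_div_iff₀ hr, sq, mul_assoc]
        gcongr
      have h6 : 0 ≤ (1 + 2⁻¹ * ‖Q‖) * ‖v‖ ^ 2 := by positivity
      linarith [add_mul (2 * B / r ^ 2) (‖L‖ / r) (‖v‖ ^ 2)]
  have hC0 : Integrable fun u => C * (gaussK d u * ‖u‖ ^ 2) :=
    integrable_gaussK_mul_norm_sq.const_mul C
  have hlim := (tendsto_integral_gaussK_mul_comp_smul hmeas hC hFQ).const_mul
    ((volume N).toReal)⁻¹
  have hlap : eucLap d f p = ∑ i, Q (EuclideanSpace.single i 1) (EuclideanSpace.single i 1) := by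
    simp [eucLap, iteratedFDeriv_two_apply, Q]
  rw [hlap]
  refine hlim.congr' ?_
  filter_upwards [self_mem_nhdsWithin] with h (hh : 0 < h)
  rw [avgLap_eq_integral hNm f p hh]
  congr 1
  have hFint : Integrable fun u => gaussK d u * ((h ^ 2)⁻¹ * F (h • u)) := by
    refine hC0.mono' (continuous_gaussK.aestronglyMeasurable.mul
      ((hmeas.comp_quasiMeasurePreserving
        (Measure.quasiMeasurePreserving_smul volume hh.ne')).const_mul _))
      (.of_forall (norm_gaussK_mul_comp_smul_le hC hh))
  have hsplit (u : EuclideanSpace ℝ (Fin d)) :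
      gaussK d u * ((h ^ 2)⁻¹ * G (p + h • u)) =
        gaussK d u * ((h ^ 2)⁻¹ * F (h • u)) + h⁻¹ * (gaussK d u * L u) := by
    simp only [hFdef, map_smul, smul_eq_mul]
    field_simp
    ring
  change _ = ∫ u, gaussK d u * ((h ^ 2)⁻¹ * G (p + h • u))
  simp only [hsplit]
  rw [integral_add hFint ((integrable_gaussK_mul_clm L).const_mul _), integral_const_mul,
    integral_gaussK_mul_clm, mul_zero, add_zero]
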